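/- Let P be an augmented program and M ⊆ σ_P a set of atoms. Then P ∪ ¬M̃ is classically consistent and P ∪ ¬M̃ ⊢_C a for every a ∈ M if and only if M is a minimal model of P. -/

import Mathlib

namespace ASP

/-- Propositional formulas over atoms `α`, built with ∧, ∨, ← and ⊥.
`impl A B` denotes the formula `B ← A` (i.e. `A → B`). -/
inductive PropForm (α : Type) : Type
  | var : α → PropForm α
  | fals : PropForm α
  | conj : PropForm α → PropForm α → PropForm α
  | disj : PropForm α → PropForm α → PropForm α
  | impl : PropForm α → PropForm α → PropForm α
  deriving DecidableEq

namespace PropForm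

variable {α : Type}

/-- `¬F` abbreviates `⊥ ← F`. -/
def neg (A : PropForm α) : PropForm α := impl A fals

/-- `⊤` abbreviates `⊥ ← ⊥`. -/
def top : PropForm α := impl fals fals

/-- The set of atoms occurring in a formula. -/
def atoms : PropForm α → Set α
  | var a => {a}
  | fals => ∅
  | conj A B => atoms A ∪ atoms B
  | disj A B => atoms A ∪ atoms B
  | impl A B => atoms A ∪ atoms B

end PropForm

open PropForm

/-- Hilbert-style derivability for intuitionistic propositional logic,
with an extra set `Ax` of additional axioms. -/
inductive Deriv {α : Type} (Ax : Set (PropForm α)) : PropForm α → Prop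
  | ax {A} : A ∈ Ax → Deriv Ax A
  | k (A B) : Deriv Ax (impl A (impl B A))
  | s (A B C) : Deriv Ax (impl (impl A (impl B C)) (impl (impl A B) (impl A C)))
  | conjIntro (A B) : Deriv Ax (impl A (impl B (conj A B)))
  | conjElimL (A B) : Deriv Ax (impl (conj A B) A)
  | conjElimR (A B) : Deriv Ax (impl (conj A B) B)
  | disjIntroL (A B) : Deriv Ax (impl A (disj A B))
  | disjIntroR (A B) : Deriv Ax (impl B (disj A B))
  | disjElim (A B C) : Deriv Ax (impl (impl A C) (impl (impl B C) (impl (disj A B) C)))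
  | falsElim (A) : Deriv Ax (impl fals A)
  | mp {A B} : Deriv Ax (impl A B) → Deriv Ax A → Deriv Ax B

/-- `F` is a theorem of intuitionistic propositional logic. -/
def IThm {α : Type} (F : PropForm α) : Prop := Deriv ∅ F

/-- `F` is a theorem of classical propositional logic
(intuitionistic logic plus double-negation elimination). -/
def CThm {α : Type} (F : PropForm α) : Prop :=
  Deriv {F | ∃ A, F = impl (neg (neg A)) A} F

/-- Conjunction of a finite list of formulas (empty conjunction is ⊤). -/
def bigConj {α : Type} : List (PropForm α) → PropForm α
  | [] => top
  | [A] => A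
  | A :: L => conj A (bigConj L)

/-- Disjunction of a finite list of formulas (empty disjunction is ⊥). -/
def bigDisj {α : Type} : List (PropForm α) → PropForm α
  | [] => fals
  | [A] => A
  | A :: L => disj A (bigDisj L)

/-- `T ⊢_X F`: the formula `F ← (F₁ ∧ ... ∧ Fₙ)` is a theorem of the logic
whose theorems are `Thm`, for some `F₁, ..., Fₙ ∈ T`. -/
def ProvesFrom {α : Type} (Thm : PropForm α → Prop) (T : Set (PropForm α))
    (F : PropForm α) : Prop :=
  ∃ L : List (PropForm α), (∀ G ∈ L, G ∈ T) ∧ Thm (impl (bigConj L) F)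

/-- `T ⊢_I F`. -/
def IProves {α : Type} (T : Set (PropForm α)) (F : PropForm α) : Prop :=
  ProvesFrom IThm T F

/-- `T ⊢_C F`. -/
def CProves {α : Type} (T : Set (PropForm α)) (F : PropForm α) : Prop :=
  ProvesFrom CThm T F

/-- `T` is consistent in intuitionistic logic. -/
def IConsistent {α : Type} (T : Set (PropForm α)) : Prop := ¬ IProves T fals

/-- `T ⊩_I M`: `T` is consistent and proves (intuitionistically) every atom of `M`. -/
def IProvesAll {α : Type} (T : Set (PropForm α)) (M : Set α) : Prop :=
  IConsistent T ∧ ∀ a ∈ M, IProves T (var a)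

/-- `T ≡_I U`: the two theories prove each other's formulas intuitionistically. -/
def IEquivTh {α : Type} (T U : Set (PropForm α)) : Prop :=
  (∀ F ∈ U, IProves T F) ∧ (∀ F ∈ T, IProves U F)

/-- The signature (set of occurring atoms) of a theory. -/
def sigTh {α : Type} (T : Set (PropForm α)) : Set α := ⋃ F ∈ T, F.atoms

/-- `T` is (literal) complete: for every atom `a` of its signature,
`T ⊢_I a` or `T ⊢_I ¬a`. -/
def IComplete {α : Type} (T : Set (PropForm α)) : Prop :=
  ∀ a ∈ sigTh T, IProves T (var a) ∨ IProves T (neg (var a))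

/-- `{¬a : a ∈ S}`. -/
def negSet {α : Type} (S : Set α) : Set (PropForm α) := (fun a => neg (var a)) '' S

/-- `{¬¬a : a ∈ S}`. -/
def negnegSet {α : Type} (S : Set α) : Set (PropForm α) :=
  (fun a => neg (neg (var a))) '' S

/-- Classical two-valued satisfaction, identifying an interpretation with the
set of atoms it makes true. -/
def sat2 {α : Type} (X : Set α) : PropForm α → Prop
  | .var a => a ∈ X
  | .fals => False
  | .conj A B => sat2 X A ∧ sat2 X B
  | .disj A B => sat2 X A ∨ sat2 X B
  | .impl A B => sat2 X A → sat2 X B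

/-- `X` is a classical model of the theory `T`. -/
def isModel2 {α : Type} (X : Set α) (T : Set (PropForm α)) : Prop := ∀ F ∈ T, sat2 X F

/-- `M` is a minimal (under ⊆) classical model of `T`. -/
def isMinModel {α : Type} (T : Set (PropForm α)) (M : Set α) : Prop :=
  isModel2 M T ∧ ∀ N ⊆ M, isModel2 N T → N = M

/-- Evaluation in the 3-valued Gödel logic G3. -/
def g3 {α : Type} (I : α → Fin 3) : PropForm α → Fin 3
  | .var a => I a
  | .fals => 0
  | .conj A B => min (g3 I A) (g3 I B)
  | .disj A B => max (g3 I A) (g3 I B)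
  | .impl A B => if g3 I A ≤ g3 I B then 2 else g3 I B

/-- Nested formulas: built from atoms, ⊤ and ⊥ using ∧, ∨ and ¬. -/
inductive NF (α : Type) : Type
  | var : α → NF α
  | top : NF α
  | bot : NF α
  | conj : NF α → NF α → NF α
  | disj : NF α → NF α → NF α
  | neg : NF α → NF α
  deriving DecidableEq

namespace NF

variable {α : Type}

/-- Reading a nested formula as a propositional formula
(`⊤ = ⊥ ← ⊥` and `¬F = ⊥ ← F`). -/
def toProp : NF α → PropForm α
  | var a => .var a
  | top => PropForm.top
  | bot => .fals
  | conj A B => .conj (toProp A) (toProp B)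
  | disj A B => .disj (toProp A) (toProp B)
  | neg A => PropForm.neg (toProp A)

/-- Atoms occurring in a nested formula. -/
def atoms : NF α → Set α
  | var a => {a}
  | top => ∅
  | bot => ∅
  | conj A B => atoms A ∪ atoms B
  | disj A B => atoms A ∪ atoms B
  | neg A => atoms A

/-- Satisfaction of a (basic, negation-free) nested formula by a set of atoms. -/
def satB (X : Set α) : NF α → Prop
  | var a => a ∈ X
  | top => True
  | bot => False
  | conj A B => satB X A ∧ satB X B
  | disj A B => satB X A ∨ satB X B
  | neg A => ¬ satB X A

open scoped Classical in
/-- The reduct `F^X`: each maximal subformula `¬G` is replaced by ⊥ if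
`X ⊨ G^X` and by ⊤ otherwise. -/
noncomputable def reduct (X : Set α) : NF α → NF α
  | var a => var a
  | top => top
  | bot => bot
  | conj A B => conj (reduct X A) (reduct X B)
  | disj A B => disj (reduct X A) (reduct X B)
  | neg A => if satB X (reduct X A) then bot else top

end NF

/-- An augmented clause `H ← B` is a pair `(H, B)` of nested formulas. -/
abbrev AugClause (α : Type) := NF α × NF α

/-- The propositional formula `H ← B` of an augmented clause. -/
def clauseToProp {α : Type} (c : AugClause α) : PropForm α :=
  .impl c.2.toProp c.1.toProp

/-- The theory of an augmented program. -/
def progTh {α : Type} (P : List (AugClause α)) : Set (PropForm α) :=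
  {F | ∃ c ∈ P, clauseToProp c = F}

/-- The signature of an augmented program. -/
def progSig {α : Type} (P : List (AugClause α)) : Set α :=
  {a | ∃ c ∈ P, a ∈ c.1.atoms ∪ c.2.atoms}

/-- `X` is closed under the (basic) program `P`: for each clause `H ← B`,
`X ⊨ H` whenever `X ⊨ B`. -/
def closedUnder {α : Type} (X : Set α) (P : List (AugClause α)) : Prop :=
  ∀ c ∈ P, NF.satB X c.2 → NF.satB X c.1

/-- The reduct `P^X` of an augmented program. -/
noncomputable def progReduct {α : Type} (X : Set α) (P : List (AugClause α)) :
    List (AugClause α) :=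
  P.map fun c => (c.1.reduct X, c.2.reduct X)

/-- `M` is an answer set of `P`: `M` is minimal (under ⊆) among the sets of
atoms closed under the reduct `P^M`. -/
def isAnswerSet {α : Type} (P : List (AugClause α)) (M : Set α) : Prop :=
  closedUnder M (progReduct M P) ∧ ∀ N ⊆ M, closedUnder N (progReduct M P) → N = M

/-- `M` is a min-answer set of `P`: both an answer set and a minimal model. -/
def isMinAnswerSet {α : Type} (P : List (AugClause α)) (M : Set α) : Prop :=
  isAnswerSet P M ∧ isMinModel (progTh P) M

/-- A G3 interpretation models an augmented program. -/
def g3ModelsProg {α : Type} (I : α → Fin 3) (P : List (AugClause α)) : Prop :=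
  ∀ c ∈ P, g3 I (clauseToProp c) = 2

/-- A free clause: a list of head literals and a list of body literals,
a literal being an atom `(a, true)` or a negated atom `(a, false)`.
It denotes `h₁ ∨ ... ∨ hₙ ← b₁ ∧ ... ∧ bₘ` (empty head = ⊥, empty body = ⊤). -/
structure FClause (α : Type) where
  head : List (α × Bool)
  body : List (α × Bool)
  deriving DecidableEq

/-- The propositional formula of a literal. -/
def litToProp {α : Type} : α × Bool → PropForm α
  | (a, true) => .var a
  | (a, false) => PropForm.neg (.var a)

/-- The nested formula of a literal. -/
def litToNF {α : Type} : α × Bool → NF α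
  | (a, true) => .var a
  | (a, false) => .neg (.var a)

/-- Disjunction of a list of nested formulas (empty = ⊥). -/
def bigDisjNF {α : Type} : List (NF α) → NF α
  | [] => .bot
  | [A] => A
  | A :: L => .disj A (bigDisjNF L)

/-- Conjunction of a list of nested formulas (empty = ⊤). -/
def bigConjNF {α : Type} : List (NF α) → NF α
  | [] => .top
  | [A] => A
  | A :: L => .conj A (bigConjNF L)

namespace FClause

variable {α : Type}

/-- The propositional formula of a free clause. -/
def toProp (c : FClause α) : PropForm α :=
  .impl (bigConj (c.body.map litToProp)) (bigDisj (c.head.map litToProp))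

/-- A free clause as an augmented clause. -/
def toAug (c : FClause α) : AugClause α :=
  (bigDisjNF (c.head.map litToNF), bigConjNF (c.body.map litToNF))

/-- The atoms of a free clause. -/
def atomsF (c : FClause α) : Set α :=
  {a | (∃ b, (a, b) ∈ c.head) ∨ (∃ b, (a, b) ∈ c.body)}

/-- A general clause: all head literals are positive atoms. -/
def isGeneral (c : FClause α) : Prop := ∀ l ∈ c.head, l.2 = true

/-- A disjunctive clause: a general clause with nonempty head. -/
def isDisjunctive (c : FClause α) : Prop := c.isGeneral ∧ c.head ≠ []

/-- A constraint: a clause with empty head (head ⊥). -/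
def isConstraint (c : FClause α) : Prop := c.head = []

end FClause

/-- The theory of a free program. -/
def fTh {α : Type} (P : List (FClause α)) : Set (PropForm α) :=
  {F | ∃ c ∈ P, c.toProp = F}

/-- The signature of a free program. -/
def fSig {α : Type} (P : List (FClause α)) : Set α :=
  {a | ∃ c ∈ P, a ∈ c.atomsF}

/-- `GenDisj(P)`: each constraint `⊥ ← B` is replaced by `p ← B ∧ ¬p`,
where `p` is a new reserved atom. -/
def genDisj {α : Type} [DecidableEq α] (P : List (FClause α)) (p : α) :
    List (FClause α) :=
  P.map fun c =>
    if c.head = [] then ⟨[(p, true)], c.body ++ [(p, false)]⟩ else c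

/-- The atoms `a` such that `¬a` occurs in the head of some clause of `P`
(the set `S` of the FreeGen transformation), as a list. -/
def headNegs {α : Type} (P : List (FClause α)) : List α :=
  P.flatMap fun c => c.head.filterMap fun l => if l.2 = false then some l.1 else none

open scoped Classical in
/-- Replace the occurrence of `¬a` (for `a ∈ S`) by the positive atom `φ a`. -/
noncomputable def substLit {α : Type} (S : Set α) (φ : α → α) (l : α × Bool) :
    α × Bool :=
  if l.2 = false ∧ l.1 ∈ S then (φ l.1, true) else l

/-- Replace every occurrence of `¬a` (for `a ∈ S`) by `φ a` in a clause. -/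
noncomputable def FClause.subst {α : Type} (S : Set α) (φ : α → α) (c : FClause α) :
    FClause α :=
  ⟨c.head.map (substLit S φ), c.body.map (substLit S φ)⟩

/-- `Δ_S = ⋃_{a ∈ S} {φ(a) ← ¬a, ⊥ ← a ∧ φ(a)}`. -/
def deltaClauses {α : Type} (L : List α) (φ : α → α) : List (FClause α) :=
  L.flatMap fun a => [⟨[(φ a, true)], [(a, false)]⟩, ⟨[], [(a, true), (φ a, true)]⟩]

/-- `FreeGen(P) = P' ∪ Δ_S`. -/
noncomputable def freeGen {α : Type} (P : List (FClause α)) (φ : α → α) :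
    List (FClause α) :=
  P.map (FClause.subst {a | a ∈ headNegs P} φ) ++ deltaClauses (headNegs P) φ

open scoped Classical in
/-- The second reduction `redu2(P; ¬¬M)`: clauses whose body contains a literal
`¬a` with `a ∈ M` are deleted; in constraints, positive body literals `a ∈ M`
are deleted. -/
noncomputable def redu2 {α : Type} [DecidableEq α] (P : List (FClause α))
    (M : Set α) : List (FClause α) :=
  (P.filter fun c => decide (¬ ∃ l ∈ c.body, l.2 = false ∧ l.1 ∈ M)).map
    fun c =>
      if c.head = [] then
        ⟨[], c.body.filter fun l => decide (¬ (l.2 = true ∧ l.1 ∈ M))⟩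
      else c

/-- `P₂` is a conservative extension of `P₁`: `M₁` is an answer set of `P₁`
iff `M₂` is an answer set of `P₂`, where `M₁ = M₂ ∩ σ_{P₁}`. -/
def consExt {α : Type} (P1 P2 : List (AugClause α)) : Prop :=
  (∀ M2 : Set α, isAnswerSet P2 M2 → isAnswerSet P1 (M2 ∩ progSig P1)) ∧
  (∀ M1 : Set α, isAnswerSet P1 M1 →
    ∃ M2 : Set α, isAnswerSet P2 M2 ∧ M1 = M2 ∩ progSig P1)

/-- `P₂` is a strong conservative extension of the user program `P₁` (relative
to the user signature `U`): for every user program `P`, `P₂ ∪ P` is a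
conservative extension of `P₁ ∪ P`. -/
def strongConsExt {α : Type} (P1 P2 : List (AugClause α)) (U : Set α) : Prop :=
  ∀ P : List (AugClause α), progSig P ⊆ U → consExt (P1 ++ P) (P2 ++ P)

mutual
  /-- Negation normal form: push negations inward (no pending negation). -/
  def nnf0 {α : Type} : NF α → NF α
    | .var a => .var a
    | .top => .top
    | .bot => .bot
    | .conj A B => .conj (nnf0 A) (nnf0 B)
    | .disj A B => .disj (nnf0 A) (nnf0 B)
    | .neg A => nnf1 A
  /-- Negation normal form under one pending negation. -/
  def nnf1 {α : Type} : NF α → NF α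
    | .var a => .neg (.var a)
    | .top => .bot
    | .bot => .top
    | .conj A B => .disj (nnf1 A) (nnf1 B)
    | .disj A B => .conj (nnf1 A) (nnf1 B)
    | .neg A => nnf2 A
  /-- Negation normal form under two pending negations. -/
  def nnf2 {α : Type} : NF α → NF α
    | .var a => .neg (.neg (.var a))
    | .top => .top
    | .bot => .bot
    | .conj A B => .conj (nnf2 A) (nnf2 B)
    | .disj A B => .disj (nnf2 A) (nnf2 B)
    | .neg A => nnf1 A
end

/-- Conjunctive normal form (list of disjunction-lists of leaves). -/
def cnfNF {α : Type} : NF α → List (List (NF α))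
  | .conj A B => cnfNF A ++ cnfNF B
  | .disj A B => (cnfNF A).flatMap fun c => (cnfNF B).map fun d => c ++ d
  | F => [[F]]

/-- Disjunctive normal form (list of conjunction-lists of leaves). -/
def dnfNF {α : Type} : NF α → List (List (NF α))
  | .disj A B => dnfNF A ++ dnfNF B
  | .conj A B => (dnfNF A).flatMap fun c => (dnfNF B).map fun d => c ++ d
  | F => [[F]]

/-- Read a leaf as a literal (if it is one). -/
def leafLit {α : Type} : NF α → Option (α × Bool)
  | .var a => some (a, true)
  | .neg (.var a) => some (a, false)
  | _ => none

/-- Read a leaf `¬¬a` as the literal `¬a` to be moved to the other side. -/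
def dnegLit {α : Type} : NF α → Option (α × Bool)
  | .neg (.neg (.var a)) => some (a, false)
  | _ => none

/-- Build a free clause from a head disjunct-list and a body conjunct-list:
doubly negated atoms `¬¬a` in the head become `¬a` in the body and vice versa;
trivial clauses (⊤ in the head or ⊥ in the body) are removed. -/
def procClause {α : Type} [DecidableEq α] (hd bd : List (NF α)) :
    Option (FClause α) :=
  if NF.top ∈ hd ∨ NF.bot ∈ bd then none
  else some ⟨hd.filterMap leafLit ++ bd.filterMap dnegLit,
             bd.filterMap leafLit ++ hd.filterMap dnegLit⟩

/-- `AugFree(P)`: the free program obtained from the augmented program `P` by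
pushing negations inward, taking CNF of heads and DNF of bodies, splitting
conjunctions in heads and disjunctions in bodies into separate clauses, and
eliminating doubly negated atoms. -/
def augFree {α : Type} [DecidableEq α] (P : List (AugClause α)) :
    List (FClause α) :=
  P.flatMap fun c =>
    (cnfNF (nnf0 c.1)).flatMap fun hd =>
      (dnfNF (nnf0 c.2)).filterMap fun bd => procClause hd bd

/-- Positive formulas: no negation (in particular no ⊥) occurs. -/
def IsPositive {α : Type} : PropForm α → Prop
  | .var _ => True
  | .fals => False
  | .conj A B => IsPositive A ∧ IsPositive B
  | .disj A B => IsPositive A ∧ IsPositive B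
  | .impl A B => IsPositive A ∧ IsPositive B

/-- The set 𝐍 of two-negated formulas. -/
inductive IsTwoNeg {α : Type} : PropForm α → Prop
  | atom (a : α) : IsTwoNeg (neg (neg (var a)))
  | dneg {A} : IsTwoNeg A → IsTwoNeg (neg (neg A))
  | conj {A B} : IsTwoNeg A → IsTwoNeg B → IsTwoNeg (PropForm.conj A B)
  | disjL {A} (B) : IsTwoNeg A → IsTwoNeg (PropForm.disj A B)
  | disjR {A} (B) : IsTwoNeg A → IsTwoNeg (PropForm.disj B A)
  | himp {A} (B) : IsTwoNeg A → IsTwoNeg (PropForm.impl B A)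

namespace Deriv

variable {α : Type} {Ax : Set (PropForm α)} {A B C F : PropForm α}

/-- Induction on derivations treating all intuitionistic axiom schemes at once. -/
theorem induction_schemes {p : ∀ A, Deriv Ax A → Prop} (ax : ∀ A (h : A ∈ Ax), p A (ax h))
    (scheme : ∀ A (h : ∀ Ax', Deriv Ax' A), p A (h Ax))
    (mp : ∀ A B (d₁ : Deriv Ax (impl A B)) (d₂ : Deriv Ax A), p _ d₁ → p _ d₂ → p B (mp d₁ d₂))
    {A : PropForm α} (d : Deriv Ax A) : p A d := by
  induction d with
  | ax hA => exact ax _ hA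
  | mp _ _ ih₁ ih₂ => exact mp _ _ _ _ ih₁ ih₂
  | k => exact scheme _ fun _ => k _ _
  | s => exact scheme _ fun _ => s _ _ _
  | conjIntro => exact scheme _ fun _ => conjIntro _ _
  | conjElimL => exact scheme _ fun _ => conjElimL _ _
  | conjElimR => exact scheme _ fun _ => conjElimR _ _
  | disjIntroL => exact scheme _ fun _ => disjIntroL _ _
  | disjIntroR => exact scheme _ fun _ => disjIntroR _ _
  | disjElim => exact scheme _ fun _ => disjElim _ _ _
  | falsElim => exact scheme _ fun _ => falsElim _

theorem mono {Ax' : Set (PropForm α)} (h : Ax ⊆ Ax') (d : Deriv Ax A) : Deriv Ax' A := by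
  induction d using induction_schemes with
  | ax _ hA => exact ax (h hA)
  | mp _ _ _ _ ih₁ ih₂ => exact mp ih₁ ih₂
  | scheme _ h => exact h _

theorem weaken (A : PropForm α) (d : Deriv Ax B) : Deriv Ax (impl A B) := mp (k _ _) d

theorem mp_under (d₁ : Deriv Ax (impl A (impl B C))) (d₂ : Deriv Ax (impl A B)) :
    Deriv Ax (impl A C) := mp (mp (s _ _ _) d₁) d₂

theorem impl_refl (A : PropForm α) : Deriv Ax (impl A A) :=
  mp_under (k A (impl A A)) (k A A)

theorem impl_trans (d₁ : Deriv Ax (impl A B)) (d₂ : Deriv Ax (impl B C)) :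
    Deriv Ax (impl A C) := mp_under (weaken A d₂) d₁

/-- The deduction theorem. -/
theorem deduction (d : Deriv (insert A Ax) B) : Deriv Ax (impl A B) := by
  induction d using induction_schemes with
  | ax _ hB =>
    rcases hB with rfl | hB
    · exact impl_refl _
    · exact weaken _ (ax hB)
  | mp _ _ _ _ ih₁ ih₂ => exact mp_under ih₁ ih₂
  | scheme _ h => exact weaken _ (h _)

theorem impl_of_mem_bigConj {L : List (PropForm α)} (hA : A ∈ L) :
    Deriv Ax (impl (bigConj L) A) := by
  induction L with
  | nil => simp at hA
  | cons G L ih =>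
    cases L with
    | nil =>
      obtain rfl : A = G := by simpa using hA
      exact impl_refl _
    | cons H L =>
      rcases List.mem_cons.mp hA with rfl | hA
      · exact conjElimL _ _
      · exact impl_trans (conjElimR _ _) (ih hA)

theorem impl_bigConj {L : List (PropForm α)} (h : ∀ G ∈ L, Deriv Ax (impl A G)) :
    Deriv Ax (impl A (bigConj L)) := by
  induction L with
  | nil => exact weaken _ (impl_refl _)
  | cons G L ih =>
    cases L with
    | nil => exact h G (by simp)
    | cons H L =>
      exact mp_under (impl_trans (h G (by simp)) (conjIntro _ _))
        (ih fun K hK => h K (List.mem_cons_of_mem _ hK))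

theorem impl_bigConj_of_subset {L L' : List (PropForm α)} (h : L' ⊆ L) :
    Deriv Ax (impl (bigConj L) (bigConj L')) :=
  impl_bigConj fun _ hG => impl_of_mem_bigConj (h hG)

theorem exists_list_of_union {T : Set (PropForm α)} (d : Deriv (Ax ∪ T) A) :
    ∃ L : List (PropForm α), (∀ G ∈ L, G ∈ T) ∧ Deriv Ax (impl (bigConj L) A) := by
  induction d using induction_schemes with
  | ax A hA =>
    rcases hA with hA | hA
    · exact ⟨[], by simp, weaken _ (ax hA)⟩
    · exact ⟨[A], by simpa using hA, impl_refl _⟩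
  | mp _ _ _ _ ih₁ ih₂ =>
    obtain ⟨L₁, h₁, d₁⟩ := ih₁
    obtain ⟨L₂, h₂, d₂⟩ := ih₂
    refine ⟨L₁ ++ L₂, fun G hG => (List.mem_append.mp hG).elim (h₁ G) (h₂ G), ?_⟩
    exact mp_under
      (impl_trans (impl_bigConj_of_subset (List.subset_append_left _ _)) d₁)
      (impl_trans (impl_bigConj_of_subset (List.subset_append_right _ _)) d₂)
  | scheme _ h => exact ⟨[], by simp, weaken _ (h _)⟩

theorem exists_mem_of_sUnion {c : Set (Set (PropForm α))} (hc : IsChain (· ⊆ ·) c)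
    (hne : c.Nonempty) (d : Deriv (⋃₀ c) A) : ∃ S ∈ c, Deriv S A := by
  induction d using induction_schemes with
  | ax _ hA =>
    obtain ⟨S, hS, hA⟩ := hA
    exact ⟨S, hS, ax hA⟩
  | mp _ _ _ _ ih₁ ih₂ =>
    obtain ⟨S₁, hS₁, d₁⟩ := ih₁
    obtain ⟨S₂, hS₂, d₂⟩ := ih₂
    rcases hc.total hS₁ hS₂ with h | h
    · exact ⟨S₂, hS₂, mp (d₁.mono h) d₂⟩
    · exact ⟨S₁, hS₁, mp d₁ (d₂.mono h)⟩
  | scheme _ h =>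
    obtain ⟨S, hS⟩ := hne
    exact ⟨S, hS, h S⟩

theorem sound {X : Set α} (hX : isModel2 X Ax) (d : Deriv Ax A) : sat2 X A := by
  induction d with
  | ax hA => exact hX _ hA
  | mp _ _ ih₁ ih₂ => exact ih₁ ih₂
  | _ => simp only [sat2]; tauto

/-- Lindenbaum's lemma: a set of axioms not deriving `F` extends to a maximal such set. -/
theorem exists_maximal_not_deriv (h : ¬ Deriv Ax F) :
    ∃ S, Ax ⊆ S ∧ ¬ Deriv S F ∧ ∀ A, ¬ Deriv S A → Deriv S (impl A F) := by
  obtain ⟨S, hAx, hS⟩ := zorn_subset_nonempty {S | ¬ Deriv S F}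
    (fun c hc hchain hne => ⟨⋃₀ c, fun d => by
      obtain ⟨S, hS, d⟩ := exists_mem_of_sUnion hchain hne d
      exact hc hS d, fun S hS => Set.subset_sUnion_of_mem hS⟩) Ax h
  refine ⟨S, hAx, hS.prop, fun A hA => deduction ?_⟩
  by_contra hF
  exact hA (ax (hS.le_of_ge hF (Set.subset_insert A S) (Set.mem_insert A S)))

/-- With double negation elimination, `A → F` and `(A → B) → F` entail `F`. -/
theorem of_impl_of_impl_impl (hdne : Deriv Ax (impl (neg (neg F)) F))
    (d₁ : Deriv Ax (impl A F)) (d₂ : Deriv Ax (impl (impl A B) F)) : Deriv Ax F := by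
  refine mp hdne (deduction ?_)
  have hsub : Ax ⊆ insert (neg F) Ax := Set.subset_insert _ _
  have hF : Deriv (insert (neg F) Ax) (impl F fals) := ax (Set.mem_insert _ _)
  exact mp hF (mp (d₂.mono hsub)
    (impl_trans (impl_trans (d₁.mono hsub) hF) (falsElim B)))

theorem iff_sat2_of_maximal (hdne : Deriv Ax (impl (neg (neg F)) F)) (hF : ¬ Deriv Ax F)
    (hmax : ∀ A, ¬ Deriv Ax A → Deriv Ax (impl A F)) (A : PropForm α) :
    Deriv Ax A ↔ sat2 {a | Deriv Ax (var a)} A := by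
  induction A with
  | var a => rfl
  | fals => exact ⟨fun d => hF (mp (falsElim F) d), False.elim⟩
  | conj A B ihA ihB =>
    simp only [sat2, ← ihA, ← ihB]
    exact ⟨fun d => ⟨mp (conjElimL _ _) d, mp (conjElimR _ _) d⟩,
      fun d => mp (mp (conjIntro _ _) d.1) d.2⟩
  | disj A B ihA ihB =>
    simp only [sat2, ← ihA, ← ihB]
    refine ⟨fun d => ?_, fun d => d.elim (mp (disjIntroL _ _)) (mp (disjIntroR _ _))⟩
    by_contra! h
    exact hF (mp (mp (mp (disjElim _ _ _) (hmax A h.1)) (hmax B h.2)) d)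
  | impl A B ihA ihB =>
    simp only [sat2, ← ihA, ← ihB]
    refine ⟨mp, fun h => ?_⟩
    by_cases hA : Deriv Ax A
    · exact weaken A (h hA)
    · by_contra hAB
      exact hF (of_impl_of_impl_impl hdne (hmax A hA) (hmax _ hAB))

end Deriv

/-- Soundness and strong completeness of classical propositional logic. -/
theorem cProves_iff_forall_model {α : Type} {T : Set (PropForm α)} {F : PropForm α} :
    CProves T F ↔ ∀ X, isModel2 X T → sat2 X F := by
  constructor
  · rintro ⟨L, hL, d⟩ X hX
    let D : Set (PropForm α) := {F | ∃ A, F = impl (neg (neg A)) A}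
    have hmodel : isModel2 X (D ∪ T) := by
      rintro G (⟨A, rfl⟩ | hG)
      · simp only [sat2, neg]
        tauto
      · exact hX G hG
    have hconj : Deriv (D ∪ T) (bigConj L) :=
      .mp (Deriv.impl_bigConj fun G hG => .weaken top (.ax (Or.inr (hL G hG))))
        (.impl_refl _)
    exact Deriv.sound hmodel (.mp (Deriv.mono Set.subset_union_left d) hconj)
  · intro h
    by_contra hF
    obtain ⟨S, hsub, hSF, hmax⟩ :=
      Deriv.exists_maximal_not_deriv fun d => hF (Deriv.exists_list_of_union d)
    have hdne : Deriv S (impl (neg (neg F)) F) := .ax (hsub (Or.inl ⟨F, rfl⟩))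
    have key := Deriv.iff_sat2_of_maximal hdne hSF hmax
    exact hSF ((key F).2 (h _ fun G hG => (key G).1 (.ax (hsub (Or.inr hG)))))

theorem sat2_inter_iff {α : Type} {X S : Set α} {F : PropForm α} (h : F.atoms ⊆ S) :
    sat2 (X ∩ S) F ↔ sat2 X F := by
  induction F with
  | var a => exact and_iff_left (h rfl)
  | fals => rfl
  | conj A B ihA ihB | disj A B ihA ihB | impl A B ihA ihB =>
    obtain ⟨hA, hB⟩ := Set.union_subset_iff.mp h
    simp only [sat2, ihA hA, ihB hB]

theorem NF.atoms_toProp {α : Type} (A : NF α) : A.toProp.atoms = A.atoms := by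
  induction A <;> simp_all [NF.toProp, NF.atoms, PropForm.atoms, PropForm.top, PropForm.neg]

theorem isModel2_progTh_inter_iff {α : Type} {P : List (AugClause α)} {X : Set α} :
    isModel2 (X ∩ progSig P) (progTh P) ↔ isModel2 X (progTh P) := by
  refine forall₂_congr fun F hF => sat2_inter_iff ?_
  obtain ⟨c, hc, rfl⟩ := hF
  intro a ha
  simp only [clauseToProp, PropForm.atoms, NF.atoms_toProp] at ha
  exact ⟨c, hc, ha.symm⟩

theorem isModel2_union_negSet_iff {α : Type} {T : Set (PropForm α)} {S M X : Set α} :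
    isModel2 X (T ∪ negSet (S \ M)) ↔ isModel2 X T ∧ X ∩ S ⊆ M := by
  constructor
  · intro h
    refine ⟨fun F hF => h F (Or.inl hF), fun a ha => ?_⟩
    by_contra haM
    exact h _ (Or.inr ⟨a, ⟨ha.2, haM⟩, rfl⟩) ha.1
  · rintro ⟨hT, hsub⟩ F (hF | ⟨a, ha, rfl⟩)
    · exact hT F hF
    · exact fun haX => ha.2 (hsub ⟨haX, ha.1⟩)

/-- for an augmented program `P` and `M ⊆ σ_P`,
`P ∪ ¬M̃ ⊩_C M` iff `M` is a minimal model of `P`. -/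
theorem classical_proves_iff_minimal_model {α : Type} (P : List (AugClause α))
    (M : Set α) (hM : M ⊆ progSig P) :
    (¬ CProves (progTh P ∪ negSet (progSig P \ M)) PropForm.fals ∧
        ∀ a ∈ M, CProves (progTh P ∪ negSet (progSig P \ M)) (PropForm.var a)) ↔
      isMinModel (progTh P) M := by
  simp only [cProves_iff_forall_model, isModel2_union_negSet_iff]
  constructor
  · rintro ⟨hcons, hprov⟩
    obtain ⟨X, ⟨hXP, hXM⟩, -⟩ := by simpa only [not_forall] using hcons
    have hX : X ∩ progSig P = M :=
      hXM.antisymm fun a ha => ⟨hprov a ha X ⟨hXP, hXM⟩, hM ha⟩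
    refine ⟨hX ▸ isModel2_progTh_inter_iff.2 hXP, fun N hNM hN => ?_⟩
    exact hNM.antisymm fun a ha => hprov a ha N ⟨hN, Set.inter_subset_left.trans hNM⟩
  · rintro ⟨hmod, hmin⟩
    refine ⟨fun h => h M ⟨hmod, Set.inter_subset_left⟩, fun a ha X hX => ?_⟩
    have hXM := hmin _ hX.2 (isModel2_progTh_inter_iff.2 hX.1)
    exact (hXM.symm ▸ ha : a ∈ X ∩ progSig P).1

end ASP
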